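/- Let U ⊆ ℝ^N be open and let (f_n) be a Δ-Cauchy sequence in 𝒞(U). Then there exists a subsequence (f_{p_n}) of (f_n) which is a fundamental sequence on U. -/

import Mathlib

open MeasureTheory Filter Topology Metric Pointwise

noncomputable section

/-- `ℝ^N` with the Euclidean metric. -/
abbrev Euc (N : ℕ) : Type := EuclideanSpace ℝ (Fin N)

/-- `𝒟`: smooth real-valued functions with compact support on `ℝ^N`. -/
def IsTest {N : ℕ} (φ : Euc N → ℝ) : Prop :=
  ContDiff ℝ (⊤ : ℕ∞) φ ∧ HasCompactSupport φ

/-- `s(φ) = inf {ε > 0 : supp φ ⊆ B_ε}`. -/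
def sRad {N : ℕ} (φ : Euc N → ℝ) : ℝ :=
  sInf {ε : ℝ | 0 < ε ∧ tsupport φ ⊆ ball (0 : Euc N) ε}

/-- `𝒟₀`: test functions that are nonnegative with integral 1. -/
def IsD0 {N : ℕ} (φ : Euc N → ℝ) : Prop :=
  IsTest φ ∧ (∀ x, 0 ≤ φ x) ∧ (∫ x, φ x) = 1

/-- Delta sequences: sequences in `𝒟₀` with `s(φ_n) → 0`. -/
def IsDeltaSeq {N : ℕ} (φ : ℕ → Euc N → ℝ) : Prop :=
  (∀ n, IsD0 (φ n)) ∧ Tendsto (fun n => sRad (φ n)) atTop (𝓝 0)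

/-- Convolution `(f∗φ)(x) = ∫ f(x−y)φ(y) dy` (with the convention that the
integrand vanishes wherever `φ` does). -/
def convol {N : ℕ} (f φ : Euc N → ℝ) : Euc N → ℝ :=
  fun x => ∫ y, f (x - y) * φ y

/-- `A^{-ε} = (closure (Aᶜ + B_ε))ᶜ`. -/
def erode {N : ℕ} (A : Set (Euc N)) (ε : ℝ) : Set (Euc N) :=
  (closure (Aᶜ + ball (0 : Euc N) ε))ᶜ

/-- `‖f‖_K`, the sup of `|f|` over `K`. -/
def supNormOn {N : ℕ} (f : Euc N → ℝ) (K : Set (Euc N)) : ℝ :=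
  ⨆ x ∈ K, |f x|

/-- Fundamental sequence on `U`: a sequence of continuous functions such that for
every compact `K ⊆ U` there is a delta sequence `δ` with `(f_n∗δ_m)_n` uniformly
convergent on `K` for every `m` (all but finitely many `m`, per the paper's
convention on definedness of the convolutions). -/
def IsFundamental {N : ℕ} (f : ℕ → Euc N → ℝ) (U : Set (Euc N)) : Prop :=
  (∀ n, ContinuousOn (f n) U) ∧
  ∀ K : Set (Euc N), IsCompact K → K ⊆ U →
    ∃ δ : ℕ → Euc N → ℝ, IsDeltaSeq δ ∧ ∃ m₀ : ℕ, ∀ m ≥ m₀,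
      ∃ g : Euc N → ℝ, TendstoUniformlyOn (fun n => convol (f n) (δ m)) g atTop K

/-- `(f_n) ∼ (g_n)` on `U`: for every compact `K ⊆ U` there is a delta sequence `φ`
with `(f_n − g_n)∗φ_m ⇉ 0` on `K` as `n → ∞`, for every (sufficiently large) `m`. -/
def SimTo {N : ℕ} (f g : ℕ → Euc N → ℝ) (U : Set (Euc N)) : Prop :=
  ∀ K : Set (Euc N), IsCompact K → K ⊆ U →
    ∃ φ : ℕ → Euc N → ℝ, IsDeltaSeq φ ∧ ∃ m₀ : ℕ, ∀ m ≥ m₀,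
      TendstoUniformlyOn (fun n => convol (fun y => f n y - g n y) (φ m)) 0 atTop K

/-- `(g_n)` is `Δ`-convergent to `0` on `U`: for every compact `K ⊆ U` there is a
delta sequence `(δ_n)` with `‖g_n∗δ_n‖_K → 0`. -/
def DeltaConvZero {N : ℕ} (g : ℕ → Euc N → ℝ) (U : Set (Euc N)) : Prop :=
  ∀ K : Set (Euc N), IsCompact K → K ⊆ U →
    ∃ δ : ℕ → Euc N → ℝ, IsDeltaSeq δ ∧
      Tendsto (fun n => supNormOn (convol (g n) (δ n)) K) atTop (𝓝 0)

/-- Tail laws of an independent sum of small random vectors. -/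
lemma exists_tail {N : ℕ} (μ : ℕ → Measure (Euc N)) [∀ n, IsProbabilityMeasure (μ n)]
    (hμ : ∀ n, ∀ᵐ x ∂(μ n), ‖x‖ < (1 / 2 : ℝ) ^ n) :
    ∃ ν : ℕ → Measure (Euc N), (∀ n, IsProbabilityMeasure (ν n)) ∧
      (∀ n, ∀ᵐ x ∂(ν n), ‖x‖ ≤ 2 * (1 / 2 : ℝ) ^ n) ∧
      ∀ n, ν n = Measure.conv (μ n) (ν (n + 1)) := by
  classical
  let P : Measure (ℕ → Euc N) := Measure.infinitePi μ
  let X : (k : ℕ) → Euc N → Euc N := fun k => (ball (0 : Euc N) ((1 / 2 : ℝ) ^ k)).indicator id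
  have hX : ∀ k, Measurable (X k) := fun k => measurable_id.indicator measurableSet_ball
  let Y : (k : ℕ) → (ℕ → Euc N) → Euc N := fun k ω => X k (ω k)
  have hY : ∀ k, Measurable (Y k) := fun k => (hX k).comp (measurable_pi_apply k)
  have hYb : ∀ k ω, ‖Y k ω‖ ≤ (1 / 2 : ℝ) ^ k := by
    intro k ω
    simp only [Y, X, Set.indicator_apply, mem_ball_zero_iff, id]
    split_ifs with h
    · exact h.le
    · simp
  have hind : ProbabilityTheory.iIndepFun Y P :=
    ProbabilityTheory.iIndepFun_infinitePi hX
  have hmap : ∀ k, P.map (Y k) = μ k := by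
    intro k
    have h1 : P.map (Y k) = (P.map (fun ω => ω k)).map (X k) := by
      rw [Measure.map_map (hX k) (measurable_pi_apply k)]; rfl
    have h2 : P.map (fun ω => ω k) = μ k := Measure.infinitePi_map_eval μ k
    rw [h1, h2]
    have : X k =ᵐ[μ k] id := by
      filter_upwards [hμ k] with x hx
      exact Set.indicator_of_mem (mem_ball_zero_iff.2 hx) _
    rw [Measure.map_congr this, Measure.map_id]
  have hgeo : ∀ m : ℕ, HasSum (fun j : ℕ => (1 / 2 : ℝ) ^ (m + j)) (2 * (1 / 2 : ℝ) ^ m) := by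
    intro m
    have := (hasSum_geometric_two).mul_left ((1 / 2 : ℝ) ^ m)
    simpa [pow_add, mul_comm] using this
  have hsum : ∀ m ω, Summable (fun j => Y (m + j) ω) := fun m ω =>
    Summable.of_norm_bounded (hgeo m).summable (fun j => hYb _ _)
  let S : ℕ → (ℕ → Euc N) → Euc N := fun m ω => ∑' j, Y (m + j) ω
  have hSmeas' : ∀ m, Measurable[⨆ i ∈ Set.Ici m, MeasurableSpace.comap (Y i) inferInstance] (S m) := by
    intro m
    refine @measurable_of_tendsto_metrizable _ _
      (⨆ i ∈ Set.Ici m, MeasurableSpace.comap (Y i) inferInstance) _ _ _ _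
      (fun n ω => ∑ j ∈ Finset.range n, Y (m + j) ω) _ ?_ ?_
    · intro n
      refine @Finset.measurable_sum _ _ _ _ _ _
        (⨆ i ∈ Set.Ici m, MeasurableSpace.comap (Y i) inferInstance) _ _ ?_
      intro j _
      have h1 : Measurable[MeasurableSpace.comap (Y (m + j)) inferInstance] (Y (m + j)) :=
        comap_measurable _
      refine h1.mono ?_ le_rfl
      exact le_iSup₂_of_le (m + j) (by simp) le_rfl
    · rw [tendsto_pi_nhds]
      intro ω
      exact (hsum m ω).hasSum.tendsto_sum_nat
  have hSmeas : ∀ m, Measurable (S m) := by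
    intro m
    refine (hSmeas' m).mono ?_ le_rfl
    exact iSup₂_le fun i _ => (hY i).comap_le
  have hrec : ∀ m, S m = Y m + S (m + 1) := by
    intro m
    funext ω
    have := (hsum m ω).tsum_eq_zero_add
    simp only [S, Pi.add_apply]
    rw [this]
    congr 1
    refine tsum_congr fun b => ?_
    rw [show m + (b + 1) = m + 1 + b by ring]
  have hSind : ∀ m, ProbabilityTheory.IndepFun (Y m) (S (m + 1)) P := by
    intro m
    have h := ProbabilityTheory.indep_iSup_of_disjoint (fun i => (hY i).comap_le) hind
      (S := {m}) (T := Set.Ici (m + 1)) (by simp)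
    rw [ProbabilityTheory.IndepFun_iff_Indep]
    refine ProbabilityTheory.indep_of_indep_of_le_left
      (ProbabilityTheory.indep_of_indep_of_le_right h ?_) ?_
    · exact (hSmeas' (m + 1)).comap_le
    · exact le_iSup₂_of_le m (by simp) le_rfl
  refine ⟨fun m => P.map (S m), fun m => Measure.isProbabilityMeasure_map (hSmeas m).aemeasurable,
    fun m => ?_, fun m => ?_⟩
  · rw [ae_map_iff (hSmeas m).aemeasurable (measurableSet_le measurable_norm measurable_const)]
    refine Filter.Eventually.of_forall fun ω => ?_
    exact tsum_of_norm_bounded (hgeo m) (fun j => hYb _ _)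
  · show P.map (S m) = _
    rw [hrec m, (hSind m).map_add_eq_map_conv_map (hY m) (hSmeas _), hmap]

/-- The measure with density `φ`. -/
def dens {N : ℕ} (φ : Euc N → ℝ) : Measure (Euc N) :=
  volume.withDensity (fun x => ENNReal.ofReal (φ x))

lemma IsD0.measurable_ofReal {N : ℕ} {φ : Euc N → ℝ} (h : IsD0 φ) :
    Measurable (fun x => ENNReal.ofReal (φ x)) :=
  h.1.1.continuous.measurable.ennreal_ofReal

lemma IsD0.integrable {N : ℕ} {φ : Euc N → ℝ} (h : IsD0 φ) : Integrable φ :=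
  h.1.1.continuous.integrable_of_hasCompactSupport h.1.2

lemma IsD0.isProb {N : ℕ} {φ : Euc N → ℝ} (h : IsD0 φ) : IsProbabilityMeasure (dens φ) := by
  refine ⟨?_⟩
  rw [dens, withDensity_apply _ MeasurableSet.univ, Measure.restrict_univ,
    ← ofReal_integral_eq_lintegral_ofReal h.integrable (Filter.Eventually.of_forall h.2.1), h.2.2]
  simp

lemma IsD0.ae_norm_lt {N : ℕ} {φ : Euc N → ℝ} (h : IsD0 φ) {r : ℝ}
    (hr : tsupport φ ⊆ ball (0 : Euc N) r) : ∀ᵐ x ∂(dens φ), ‖x‖ < r := by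
  rw [dens, ae_withDensity_iff h.measurable_ofReal]
  refine Filter.Eventually.of_forall fun x hx => ?_
  refine mem_ball_zero_iff.1 (hr (subset_tsupport _ ?_))
  intro h0
  apply hx
  simp [h0]

lemma IsD0.convol_eq {N : ℕ} {φ : Euc N → ℝ} (h : IsD0 φ) (f : Euc N → ℝ) (x : Euc N) :
    convol f φ x = ∫ y, f (x - y) ∂(dens φ) := by
  rw [dens, integral_withDensity_eq_integral_toReal_smul h.measurable_ofReal
    (Filter.Eventually.of_forall fun x => ENNReal.ofReal_lt_top)]
  refine integral_congr_ae (Filter.Eventually.of_forall fun y => ?_)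
  simp only [ENNReal.toReal_ofReal (h.2.1 y), smul_eq_mul]
  ring

/-- Convolution of a test function in `𝒟₀` with a small probability measure. -/
lemma smoothing {N : ℕ} {φ : Euc N → ℝ} (h : IsD0 φ) {r s : ℝ}
    (hr : tsupport φ ⊆ ball (0 : Euc N) r) (ν : Measure (Euc N)) [IsProbabilityMeasure ν]
    (hs : ∀ᵐ x ∂ν, ‖x‖ ≤ s) :
    ∃ δ : Euc N → ℝ, IsD0 δ ∧ tsupport δ ⊆ closedBall (0 : Euc N) (r + s) ∧
      dens δ = Measure.conv (dens φ) ν := by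
  have hφc := h.1.1.continuous
  let δ : Euc N → ℝ := fun x => ∫ t, φ (x - t) ∂ν
  have hsupp : tsupport δ ⊆ closedBall (0 : Euc N) (r + s) := by
    refine closure_minimal ?_ isClosed_closedBall
    intro x hx
    by_contra hx'
    apply hx
    refine integral_eq_zero_of_ae ?_
    filter_upwards [hs] with t ht
    by_contra h0
    have h1 := mem_ball_zero_iff.1 (hr (subset_tsupport _ h0))
    apply hx'
    rw [mem_closedBall_zero_iff]
    calc ‖x‖ = ‖(x - t) + t‖ := by simp
      _ ≤ ‖x - t‖ + ‖t‖ := norm_add_le _ _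
      _ ≤ r + s := by linarith
  have hsm : ContDiff ℝ (⊤ : ℕ∞) δ := by
    have h1 := h.1.2.contDiff_convolution_right (n := ⊤) (ContinuousLinearMap.mul ℝ ℝ) (μ := ν)
      (f := fun _ => (1 : ℝ)) (locallyIntegrable_const 1) h.1.1
    convert h1 using 1
    funext x
    simp [δ, convolution]
  have hnn : ∀ x, 0 ≤ δ x := fun x => integral_nonneg fun t => h.2.1 _
  have hcs : HasCompactSupport δ := by
    exact IsCompact.of_isClosed_subset (isCompact_closedBall _ _) (isClosed_tsupport _) hsupp
  have := h.isProb
  have hdm : Measurable (fun x => ENNReal.ofReal (δ x)) := hsm.continuous.measurable.ennreal_ofReal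
  obtain ⟨C, hC⟩ := h.1.2.exists_bound_of_continuous hφc
  have hδl : ∀ x, ENNReal.ofReal (δ x) = ∫⁻ t, ENNReal.ofReal (φ (x - t)) ∂ν := by
    intro x
    refine ofReal_integral_eq_lintegral_ofReal ?_ (Filter.Eventually.of_forall fun t => h.2.1 _)
    refine Integrable.of_bound (C := C) ?_ (Filter.Eventually.of_forall fun t => hC _)
    exact (hφc.comp (continuous_const.sub continuous_id)).aestronglyMeasurable
  have hde : dens δ = Measure.conv (dens φ) ν := by
    refine Measure.ext_of_lintegral _ fun g hg => ?_
    rw [Measure.conv_comm, Measure.lintegral_conv hg, dens,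
      lintegral_withDensity_eq_lintegral_mul _ hdm hg]
    have e1 : ∀ t : Euc N, ∫⁻ y, g (t + y) ∂(dens φ)
        = ∫⁻ x, ENNReal.ofReal (φ (x - t)) * g x := by
      intro t
      have hg' : Measurable (fun y => g (t + y)) := hg.comp (measurable_const_add t)
      rw [dens, lintegral_withDensity_eq_lintegral_mul _ h.measurable_ofReal hg',
        ← lintegral_sub_right_eq_self _ t]
      simp
    simp_rw [e1]
    have hm2 : Measurable (fun p : Euc N × Euc N => ENNReal.ofReal (φ (p.2 - p.1)) * g p.2) := by
      refine Measurable.mul ?_ (hg.comp measurable_snd)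
      exact h.measurable_ofReal.comp (measurable_snd.sub measurable_fst)
    rw [lintegral_lintegral_swap hm2.aemeasurable]
    refine lintegral_congr fun x => ?_
    rw [lintegral_mul_const, Pi.mul_apply, hδl x]
    exact h.measurable_ofReal.comp (measurable_const.sub measurable_id)
  refine ⟨δ, ⟨⟨hsm, hcs⟩, hnn, ?_⟩, hsupp, hde⟩
  have h1 : dens δ Set.univ = 1 := by rw [hde]; exact measure_univ
  rw [dens, withDensity_apply _ MeasurableSet.univ, Measure.restrict_univ,
    ← ofReal_integral_eq_lintegral_ofReal
      (hsm.continuous.integrable_of_hasCompactSupport hcs) (Filter.Eventually.of_forall hnn)] at h1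
  exact ENNReal.ofReal_eq_one.1 h1

lemma tsupport_subset_of_sRad_lt {N : ℕ} {φ : Euc N → ℝ} (h : IsD0 φ) {ε : ℝ}
    (hε : sRad φ < ε) : tsupport φ ⊆ ball (0 : Euc N) ε := by
  have hne : {ε : ℝ | 0 < ε ∧ tsupport φ ⊆ ball (0 : Euc N) ε}.Nonempty := by
    obtain ⟨R, hR⟩ := h.1.2.isBounded.subset_ball (0 : Euc N)
    exact ⟨max R 1, by positivity, hR.trans (ball_subset_ball (le_max_left _ _))⟩
  obtain ⟨a, ⟨_, ha⟩, hlt⟩ := exists_lt_of_csInf_lt hne hε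
  exact ha.trans (ball_subset_ball hlt.le)

lemma sRad_nonneg {N : ℕ} (φ : Euc N → ℝ) : 0 ≤ sRad φ :=
  Real.sInf_nonneg fun _ hx => hx.1.le

lemma sRad_le {N : ℕ} {φ : Euc N → ℝ} {ε : ℝ} (hε : 0 < ε)
    (h : tsupport φ ⊆ ball (0 : Euc N) ε) : sRad φ ≤ ε :=
  csInf_le ⟨0, fun _ hx => hx.1.le⟩ ⟨hε, h⟩

/-- Factorisation of tail measures. -/
lemma tail_factor {N : ℕ} (μ ν : ℕ → Measure (Euc N)) [∀ n, IsProbabilityMeasure (μ n)]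
    [∀ n, IsProbabilityMeasure (ν n)]
    (hμ : ∀ n, ∀ᵐ x ∂(μ n), ‖x‖ < (1 / 2 : ℝ) ^ n)
    (hν : ∀ n, ∀ᵐ x ∂(ν n), ‖x‖ ≤ 2 * (1 / 2 : ℝ) ^ n)
    (hc : ∀ n, ν n = Measure.conv (μ n) (ν (n + 1))) (k : ℕ) : ∀ m : ℕ,
    ∃ ρ : Measure (Euc N), IsProbabilityMeasure ρ ∧ (∀ᵐ x ∂ρ, ‖x‖ ≤ 2 * (1 / 2 : ℝ) ^ m) ∧
      ν m = Measure.conv (μ (m + k)) ρ := by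
  induction k with
  | zero =>
    intro m
    refine ⟨ν (m + 1), inferInstance, ?_, hc m⟩
    filter_upwards [hν (m + 1)] with x hx
    have : (0 : ℝ) < (1 / 2 : ℝ) ^ m := by positivity
    rw [pow_succ] at hx
    linarith
  | succ k ih =>
    intro m
    obtain ⟨ρ, hρ, hρb, hρc⟩ := ih (m + 1)
    refine ⟨Measure.conv (μ m) ρ, inferInstance, ?_, ?_⟩
    · rw [Measure.conv, ae_map_iff (measurable_add.aemeasurable)
        (measurableSet_le measurable_norm measurable_const)]
      have h1 : ∀ᵐ p ∂((μ m).prod ρ), ‖p.1‖ < (1 / 2 : ℝ) ^ m :=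
        Measure.quasiMeasurePreserving_fst.ae (hμ m)
      have h2 : ∀ᵐ p ∂((μ m).prod ρ), ‖p.2‖ ≤ 2 * (1 / 2 : ℝ) ^ (m + 1) :=
        Measure.quasiMeasurePreserving_snd.ae hρb
      filter_upwards [h1, h2] with p hp1 hp2
      refine (norm_add_le _ _).trans ?_
      rw [pow_succ] at hp2
      linarith
    · rw [hc m, hρc, ← Measure.conv_assoc, Measure.conv_comm (μ m), Measure.conv_assoc,
        show m + 1 + k = m + (k + 1) by ring]

lemma sub_mem_cthickening {N : ℕ} {K : Set (Euc N)} {r : ℝ} {x y : Euc N} (hx : x ∈ K)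
    (hy : ‖y‖ ≤ r) : x - y ∈ cthickening r K := by
  refine mem_cthickening_of_dist_le (x - y) x r K hx ?_
  simpa [dist_eq_norm] using hy

lemma abs_convol_le {N : ℕ} {K : Set (Euc N)} {r C : ℝ} {g φ : Euc N → ℝ} (h : IsD0 φ)
    (hr : tsupport φ ⊆ ball (0 : Euc N) r) (hC : ∀ x ∈ cthickening r K, |g x| ≤ C)
    {x : Euc N} (hx : x ∈ K) : |convol g φ x| ≤ C := by
  have := h.isProb
  rw [h.convol_eq, ← Real.norm_eq_abs]
  have h1 : ∀ᵐ y ∂(dens φ), ‖g (x - y)‖ ≤ C := by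
    filter_upwards [h.ae_norm_lt hr] with y hy
    exact hC _ (sub_mem_cthickening hx hy.le)
  simpa using norm_integral_le_of_norm_le_const h1

lemma le_supNormOn {N : ℕ} {K : Set (Euc N)} {u : Euc N → ℝ} {C : ℝ}
    (hC : ∀ x ∈ K, |u x| ≤ C) {x : Euc N} (hx : x ∈ K) : |u x| ≤ supNormOn u K := by
  have hC0 : 0 ≤ C := (abs_nonneg _).trans (hC x hx)
  have hb : BddAbove (Set.range fun x => ⨆ (_ : x ∈ K), |u x|) := by
    refine ⟨C, ?_⟩
    rintro _ ⟨z, rfl⟩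
    exact Real.iSup_le (fun hz => hC z hz) hC0
  refine le_trans ?_ (le_ciSup hb x)
  simp [hx]

/-- The quantitative form of the Cauchy condition. -/
lemma key_claim {N : ℕ} (U : Set (Euc N)) (hU : IsOpen U)
    (f : ℕ → Euc N → ℝ) (hf : ∀ n, ContinuousOn (f n) U)
    (hC : ∀ p q : ℕ → ℕ, StrictMono p → StrictMono q →
      DeltaConvZero (fun n x => f (p n) x - f (q n) x) U)
    (K : Set (Euc N)) (hK : IsCompact K) (hKU : K ⊆ U) (ε : ℝ) (hε : 0 < ε) :
    ∃ n₀ : ℕ, ∀ m ≥ n₀, ∀ n ≥ n₀, ∃ φ : Euc N → ℝ, IsD0 φ ∧ sRad φ < ε ∧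
      ∀ x ∈ K, |convol (fun y => f m y - f n y) φ x| ≤ ε := by
  by_contra hcon
  push Not at hcon
  choose M hM L hL hbad using hcon
  let k : ℕ → ℕ := fun j => Nat.rec 0 (fun _ i => max (M i) (L i) + 1) j
  have hk : ∀ j, k (j + 1) = max (M (k j)) (L (k j)) + 1 := fun j => rfl
  have hp : StrictMono (fun j => M (k j)) := by
    refine strictMono_nat_of_lt_succ fun j => ?_
    have h1 := hM (k (j + 1))
    have h2 := hk j
    have h3 := le_max_left (M (k j)) (L (k j))
    show M (k j) < M (k (j + 1))
    omega
  have hq : StrictMono (fun j => L (k j)) := by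
    refine strictMono_nat_of_lt_succ fun j => ?_
    have h1 := hL (k (j + 1))
    have h2 := hk j
    have h3 := le_max_right (M (k j)) (L (k j))
    show L (k j) < L (k (j + 1))
    omega
  obtain ⟨δ, ⟨hδ, hδs⟩, hlim⟩ := hC _ _ hp hq K hK hKU
  obtain ⟨r, hr, hrU⟩ := hK.exists_cthickening_subset_open hU hKU
  have e1 := hδs.eventually (gt_mem_nhds hr)
  have e2 := hδs.eventually (gt_mem_nhds hε)
  have e3 := hlim.eventually (gt_mem_nhds hε)
  obtain ⟨j, h1, h2, h3⟩ := (e1.and (e2.and e3)).exists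
  obtain ⟨x, hx, hxb⟩ := hbad (k j) (δ j) (hδ j) h2
  have hcont : ContinuousOn (fun y => f (M (k j)) y - f (L (k j)) y) (cthickening r K) :=
    ((hf _).sub (hf _)).mono hrU
  obtain ⟨C, hCb⟩ := hK.cthickening.exists_bound_of_continuousOn hcont
  have hle := le_supNormOn (fun z hz => abs_convol_le (hδ j)
    (tsupport_subset_of_sRad_lt (hδ j) h1) hCb hz) hx
  exact absurd (hle.trans_lt h3) (not_lt.2 hxb.le)

lemma exists_exhaustion {N : ℕ} (U : Set (Euc N)) (hU : IsOpen U) :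
    ∃ K : ℕ → Set (Euc N), (∀ n, IsCompact (K n)) ∧ (∀ n, K n ⊆ U) ∧ Monotone K ∧
      ∀ C, IsCompact C → C ⊆ U → ∃ n, C ⊆ K n := by
  have : LocallyCompactSpace U := hU.locallyCompactSpace
  let E : CompactExhaustion U := default
  refine ⟨fun n => Subtype.val '' E n, fun n => (E.isCompact n).image continuous_subtype_val,
    fun n => by simp, fun a b hab => Set.image_mono (E.subset hab), fun C hC hCU => ?_⟩
  have hC' : IsCompact (Subtype.val ⁻¹' C : Set U) := by
    rw [Subtype.isCompact_iff, Set.image_preimage_eq_of_subset (by simpa using hCU)]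
    exact hC
  obtain ⟨n, hn⟩ := E.exists_superset_of_isCompact hC'
  exact ⟨n, fun x hx => ⟨⟨x, hCU hx⟩, hn hx, rfl⟩⟩

/-- Geometric increments give uniform convergence. -/
lemma tendstoUniformlyOn_of_geom {N : ℕ} (u : ℕ → Euc N → ℝ) (K : Set (Euc N)) (n₁ : ℕ)
    (h : ∀ n ≥ n₁, ∀ x ∈ K, |u n x - u (n + 1) x| ≤ (1 / 2 : ℝ) ^ n) :
    ∃ g, TendstoUniformlyOn u g atTop K := by
  have key : ∀ x, ∃ l : ℝ, x ∈ K → ∀ n, |u (n + n₁) x - l| ≤ 2 * (1 / 2 : ℝ) ^ n := by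
    intro x
    by_cases hx : x ∈ K
    · have hd : ∀ n, dist (u (n + n₁) x) (u (n + 1 + n₁) x) ≤ 1 * (1 / 2 : ℝ) ^ n := by
        intro n
        rw [Real.dist_eq, show n + 1 + n₁ = n + n₁ + 1 by ring, one_mul]
        refine (h (n + n₁) (by omega) x hx).trans ?_
        exact pow_le_pow_of_le_one (by norm_num) (by norm_num) (by omega)
      have hcs := cauchySeq_of_le_geometric (1 / 2 : ℝ) 1 (by norm_num) hd
      obtain ⟨l, hl⟩ := cauchySeq_tendsto_of_complete hcs
      refine ⟨l, fun _ n => ?_⟩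
      have := dist_le_of_le_geometric_of_tendsto (1 / 2 : ℝ) 1 (by norm_num) hd hl n
      rw [Real.dist_eq] at this
      refine this.trans (le_of_eq ?_)
      ring
    · exact ⟨0, fun hx' => absurd hx' hx⟩
  choose g hg using key
  refine ⟨g, ?_⟩
  rw [Metric.tendstoUniformlyOn_iff]
  intro ε hε
  have hz : Tendsto (fun n : ℕ => 2 * (1 / 2 : ℝ) ^ n) atTop (𝓝 (2 * 0)) :=
    (tendsto_pow_atTop_nhds_zero_of_lt_one (by norm_num) (by norm_num)).const_mul 2
  rw [mul_zero] at hz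
  obtain ⟨n, hn⟩ := (hz.eventually (gt_mem_nhds hε)).exists
  filter_upwards [eventually_ge_atTop (n + n₁)] with j hj x hx
  have h1 := hg x hx (j - n₁)
  rw [Nat.sub_add_cancel (by omega)] at h1
  rw [dist_comm, Real.dist_eq]
  refine h1.trans_lt (lt_of_le_of_lt ?_ hn)
  have : (1 / 2 : ℝ) ^ (j - n₁) ≤ (1 / 2 : ℝ) ^ n :=
    pow_le_pow_of_le_one (by norm_num) (by norm_num) (by omega)
  linarith

/-- Every `Δ`-Cauchy sequence of continuous functions on an open `U ⊆ ℝ^N` has a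
subsequence which is a fundamental sequence on `U`. -/
theorem deltaCauchy_subseq_fundamental {N : ℕ} (U : Set (Euc N)) (hU : IsOpen U)
    (f : ℕ → Euc N → ℝ) (hf : ∀ n, ContinuousOn (f n) U)
    (hC : ∀ p q : ℕ → ℕ, StrictMono p → StrictMono q →
      DeltaConvZero (fun n x => f (p n) x - f (q n) x) U) :
    ∃ p : ℕ → ℕ, StrictMono p ∧ IsFundamental (fun n => f (p n)) U := by

  obtain ⟨Q, hQc, hQU, hQm, hQe⟩ := exists_exhaustion U hU
  have hpos : ∀ n : ℕ, (0 : ℝ) < (1 / 2 : ℝ) ^ n := fun n => by positivity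
  have hcl := fun n : ℕ =>
    key_claim U hU f hf hC (Q n) (hQc n) (hQU n) ((1 / 2 : ℝ) ^ n) (hpos n)
  choose n₀ hn₀ using hcl
  obtain ⟨p, hpm, hpn⟩ : ∃ p : ℕ → ℕ, StrictMono p ∧ ∀ n, n₀ n ≤ p n :=
    Filter.extraction_forall_of_eventually' (fun n => ⟨n₀ n, fun k hk => hk⟩)
  have hphi := fun n => hn₀ n (p n) (hpn n) (p (n + 1)) ((hpn n).trans (hpm (Nat.lt_succ_self n)).le)
  choose φ hφ hφs hφb using hphi
  have hφt : ∀ n, tsupport (φ n) ⊆ ball (0 : Euc N) ((1 / 2 : ℝ) ^ n) :=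
    fun n => tsupport_subset_of_sRad_lt (hφ n) (hφs n)
  have hprob : ∀ n, IsProbabilityMeasure (dens (φ n)) := fun n => (hφ n).isProb
  have hμ : ∀ n, ∀ᵐ x ∂(dens (φ n)), ‖x‖ < (1 / 2 : ℝ) ^ n := fun n => (hφ n).ae_norm_lt (hφt n)
  obtain ⟨ν, hνp, hνb, hνc⟩ := exists_tail (fun n => dens (φ n)) hμ
  have hδ := fun n => smoothing (hφ n) (hφt n) (ν (n + 1)) (hνb (n + 1))
  choose δ hδ0 hδt hδd using hδ
  have hδν : ∀ n, dens (δ n) = ν n := fun n => (hδd n).trans (hνc n).symm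
  have hz : Tendsto (fun n : ℕ => 4 * (1 / 2 : ℝ) ^ n) atTop (𝓝 0) := by
    have := (tendsto_pow_atTop_nhds_zero_of_lt_one (r := (1 / 2 : ℝ))
      (by norm_num) (by norm_num)).const_mul 4
    simpa using this
  have hδs : IsDeltaSeq δ := by
    refine ⟨hδ0, ?_⟩
    refine squeeze_zero (fun n => sRad_nonneg _) (fun n => ?_) hz
    refine sRad_le (by have := hpos n; linarith) ((hδt n).trans (closedBall_subset_ball ?_))
    have := hpos n
    rw [pow_succ]
    linarith
  refine ⟨p, hpm, fun n => hf _, fun K hK hKU => ⟨δ, hδs, ?_⟩⟩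
  obtain ⟨r, hr, hrU⟩ := hK.exists_cthickening_subset_open hU hKU
  obtain ⟨m₀, hm₀⟩ := (hz.eventually (gt_mem_nhds hr)).exists
  obtain ⟨n₁, hn₁⟩ := hQe _ hK.cthickening hrU
  refine ⟨m₀, fun m hm => tendstoUniformlyOn_of_geom _ K (max n₁ m) ?_⟩
  intro n hn x hx
  have hmr : 4 * (1 / 2 : ℝ) ^ m < r := by
    have : (1 / 2 : ℝ) ^ m ≤ (1 / 2 : ℝ) ^ m₀ :=
      pow_le_pow_of_le_one (by norm_num) (by norm_num) hm
    linarith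
  have hmn : (1 / 2 : ℝ) ^ n ≤ (1 / 2 : ℝ) ^ m :=
    pow_le_pow_of_le_one (by norm_num) (by norm_num) ((le_max_right _ _).trans hn)
  have hmp := hpos m
  set C := cthickening r K with hCdef
  -- truncated functions
  let F : ℕ → Euc N → ℝ := fun i => C.indicator (f (p i))
  have hCc : IsCompact C := hK.cthickening
  have hFm : ∀ i, Measurable (F i) := by
    intro i
    have h1 : ContinuousOn (f (p i)) C := (hf (p i)).mono hrU
    classical
    have h2 := h1.measurable_piecewise (g := fun _ => (0 : ℝ)) continuousOn_const
      hCc.isClosed.measurableSet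
    convert h2 using 1
    funext z
    simp [F, Set.indicator_apply, Set.piecewise]
  have hFb : ∀ i, ∃ B, ∀ z, ‖F i z‖ ≤ B := by
    intro i
    obtain ⟨B, hB⟩ := hCc.exists_bound_of_continuousOn ((hf (p i)).mono hrU)
    refine ⟨max B 0, fun z => ?_⟩
    by_cases hz : z ∈ C
    · simp only [F, Set.indicator_of_mem hz]
      exact (hB z hz).trans (le_max_left _ _)
    · simp [F, Set.indicator_of_notMem hz]
  have hFint : ∀ i (κ : Measure (Euc N)) [IsProbabilityMeasure κ],
      Integrable (fun y => F i (x - y)) κ := by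
    intro i κ _
    obtain ⟨B, hB⟩ := hFb i
    exact Integrable.of_bound ((hFm i).comp (measurable_const.sub measurable_id)).aestronglyMeasurable
      B (Filter.Eventually.of_forall fun y => hB _)
  have hcv : ∀ i, convol (f (p i)) (δ m) x = ∫ y, F i (x - y) ∂(ν m) := by
    intro i
    rw [(hδ0 m).convol_eq, hδν]
    refine integral_congr_ae ?_
    filter_upwards [hνb m] with y hy
    have : x - y ∈ C := sub_mem_cthickening hx (by linarith)
    simp [F, Set.indicator_of_mem this]
  obtain ⟨ρ, hρp, hρb, hρc⟩ := tail_factor (fun n => dens (φ n)) ν hμ hνb hνc (n - m) m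
  rw [show m + (n - m) = n by have := le_max_right n₁ m; omega] at hρc
  have hfin : |∫ y, (F n (x - y) - F (n + 1) (x - y)) ∂(ν m)| ≤ (1 / 2 : ℝ) ^ n := by
    have hI := (hFint n (ν m)).sub (hFint (n + 1) (ν m))
    have hρc' : ν m = Measure.conv ρ (dens (φ n)) := by rw [hρc, Measure.conv_comm]
    rw [hρc'] at hI ⊢
    have hic := integral_conv hI
    simp only [Pi.sub_apply] at hic
    rw [hic, ← Real.norm_eq_abs]
    have hae : ∀ᵐ z ∂ρ, ‖∫ y, (F n (x - (z + y)) - F (n + 1) (x - (z + y))) ∂(dens (φ n))‖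
        ≤ (1 / 2 : ℝ) ^ n := by
      filter_upwards [hρb] with z hz'
      have hxz : x - z ∈ Q n := hQm ((le_max_left _ _).trans hn)
        (hn₁ (sub_mem_cthickening hx (by linarith)))
      have hb := hφb n (x - z) hxz
      rw [(hφ n).convol_eq] at hb
      rw [Real.norm_eq_abs]
      refine le_trans (le_of_eq ?_) hb
      congr 1
      refine integral_congr_ae ?_
      filter_upwards [hμ n] with y hy
      have h1 : x - (z + y) ∈ C := by
        refine sub_mem_cthickening hx ((norm_add_le _ _).trans ?_)
        linarith
      simp only [F, Set.indicator_of_mem h1]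
      rw [sub_sub]
    simpa using norm_integral_le_of_norm_le_const hae
  rw [hcv, hcv, ← integral_sub (hFint n _) (hFint (n + 1) _)]
  exact hfin
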